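/- (Talagrand's convex distance inequality for the multislice.) For every subset A ⊆ Ω_κ, P_κ(A) · E_κ[ exp( d_T(·, A)² / 144 ) ] ≤ 1. -/

import Mathlib

open Finset Real
open scoped Classical

noncomputable section

/-- The multislice `Ω_κ ⊆ 𝒳^N`: vectors with values in `{x ℓ}` where the value `x ℓ`
appears exactly `κ ℓ` times. -/
def multislice (L N : ℕ) (κ : Fin L → ℕ) (x : Fin L → ℝ) : Finset (Fin N → ℝ) :=
  (Fintype.piFinset fun _ : Fin N => Finset.image x Finset.univ).filter
    (fun ω => ∀ ℓ : Fin L, (Finset.univ.filter fun i => ω i = x ℓ).card = κ ℓ)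

/-- Expectation with respect to the uniform distribution on a finite set. -/
def uexpect {α : Type*} (Ω : Finset α) (f : α → ℝ) : ℝ := (∑ ω ∈ Ω, f ω) / Ω.card

/-- Probability of an event with respect to the uniform distribution on a finite set. -/
def uprob {α : Type*} (Ω : Finset α) (p : α → Prop) : ℝ :=
  ((Ω.filter p).card : ℝ) / Ω.card

/-- Talagrand's convex distance `d_T(ω, A)` between a point `ω` and a set `A`. -/
def convexDist {m : ℕ} (ω : Fin m → ℝ) (A : Set (Fin m → ℝ)) : ℝ :=
  sSup { r : ℝ | ∃ α : Fin m → ℝ, (∑ i, α i ^ 2) = 1 ∧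
    r = sInf { s : ℝ | ∃ ω' ∈ A, s = ∑ i, |α i| * (if ω i = ω' i then (0 : ℝ) else 1) } }

/-- The integrand `(a - b) (log a - log b)` of the modified log-Sobolev Dirichlet form. -/
def logDiff (a b : ℝ) : ℝ := (a - b) * (log a - log b)

theorem logDiff_comm (a b : ℝ) : logDiff a b = logDiff b a := by
  unfold logDiff; ring

theorem logDiff_self (a : ℝ) : logDiff a a = 0 := by
  simp [logDiff]

theorem logDiff_nonneg {a b : ℝ} (ha : 0 < a) (hb : 0 < b) : 0 ≤ logDiff a b := by
  unfold logDiff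
  rcases le_total a b with h | h
  · exact mul_nonneg_of_nonpos_of_nonpos (sub_nonpos.2 h) (sub_nonpos.2 (log_le_log ha h))
  · exact mul_nonneg (sub_nonneg.2 h) (sub_nonneg.2 (log_le_log hb h))

/-- The log-sum inequality. -/
theorem sum_mul_log_sub_log_le {ι : Type*} (s : Finset ι) (x y : ι → ℝ)
    (hx : ∀ i ∈ s, 0 < x i) (hy : ∀ i ∈ s, 0 < y i) :
    (∑ i ∈ s, x i) * (log (∑ i ∈ s, x i) - log (∑ i ∈ s, y i)) ≤
      ∑ i ∈ s, x i * (log (x i) - log (y i)) := by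
  rcases s.eq_empty_or_nonempty with rfl | hs
  · simp
  set X := ∑ i ∈ s, x i with hX
  set Y := ∑ i ∈ s, y i with hY
  have hXpos : 0 < X := sum_pos hx hs
  have hYpos : 0 < Y := sum_pos hy hs
  have key : ∀ i ∈ s, x i * (log X - log Y) + (x i - y i * (X / Y)) ≤
      x i * (log (x i) - log (y i)) := by
    intro i hi
    have h1 := hx i hi
    have h2 := hy i hi
    have h := log_le_sub_one_of_pos (show 0 < (y i * X) / (x i * Y) by positivity)
    rw [log_div (by positivity) (by positivity), log_mul h2.ne' hXpos.ne',
      log_mul h1.ne' hYpos.ne'] at h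
    have h3 := mul_le_mul_of_nonneg_left h h1.le
    have h4 : x i * (y i * X / (x i * Y) - 1) = y i * (X / Y) - x i := by
      field_simp
    nlinarith
  have := sum_le_sum key
  rw [sum_add_distrib, ← sum_mul, sum_sub_distrib, ← sum_mul, ← hX, ← hY,
    mul_div_cancel₀ _ hYpos.ne'] at this
  linarith

theorem logDiff_sum_le {ι : Type*} (s : Finset ι) (x y : ι → ℝ)
    (hx : ∀ i ∈ s, 0 < x i) (hy : ∀ i ∈ s, 0 < y i) :
    logDiff (∑ i ∈ s, x i) (∑ i ∈ s, y i) ≤ ∑ i ∈ s, logDiff (x i) (y i) := by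
  have h1 := sum_mul_log_sub_log_le s x y hx hy
  have h2 := sum_mul_log_sub_log_le s y x hy hx
  have h3 : ∑ i ∈ s, logDiff (x i) (y i) = ∑ i ∈ s, x i * (log (x i) - log (y i)) +
      ∑ i ∈ s, y i * (log (y i) - log (x i)) := by
    rw [← sum_add_distrib]
    exact sum_congr rfl fun i _ => by unfold logDiff; ring
  rw [h3]
  unfold logDiff
  linarith

/-- The modified log-Sobolev inequality for the uniform measure on a finite set, with respect
to the complete graph. -/
theorem sum_mul_log_le_complete {ι : Type*} [Fintype ι] [Nonempty ι] (F : ι → ℝ)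
    (hF : ∀ i, 0 < F i) :
    ∑ i, F i * log (F i) - (∑ i, F i) * log ((∑ i, F i) / Fintype.card ι) ≤
      1 / (2 * Fintype.card ι) * ∑ i, ∑ j, logDiff (F i) (F j) := by
  set m : ℝ := (Fintype.card ι : ℝ) with hm
  have hmpos : 0 < m := by simp [hm, Fintype.card_pos]
  set T := ∑ i, F i with hT
  have hTpos : 0 < T := sum_pos (fun i _ => hF i) univ_nonempty
  have jensen : ∑ i, log (F i) ≤ m * log (T / m) := by
    have key : ∀ i ∈ (univ : Finset ι), log (F i) ≤ log (T / m) + (F i * (m / T) - 1) := by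
      intro i _
      have h := log_le_sub_one_of_pos
        (show 0 < F i / (T / m) from div_pos (hF i) (by positivity))
      rw [log_div (hF i).ne' (by positivity)] at h
      have : F i / (T / m) = F i * (m / T) := by field_simp
      linarith
    have := sum_le_sum key
    rw [sum_add_distrib, sum_sub_distrib, ← sum_mul, ← hT, mul_div_cancel₀ _ hTpos.ne'] at this
    simpa [← hm] using this
  have expand : ∑ i, ∑ j, logDiff (F i) (F j) =
      2 * m * ∑ i, F i * log (F i) - 2 * T * ∑ i, log (F i) := by
    have : ∀ i j, logDiff (F i) (F j) = F i * log (F i) - F i * log (F j) -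
        log (F i) * F j + F j * log (F j) := fun i j => by unfold logDiff; ring
    simp only [this, sum_add_distrib, sum_sub_distrib, ← mul_sum, ← sum_mul, sum_const,
      card_univ, nsmul_eq_mul, ← hm, ← hT]
    have : ∑ i, F i * (m * log (F i)) = m * ∑ i, F i * log (F i) := by
      rw [mul_sum]; exact sum_congr rfl fun i _ => by ring
    rw [this]
    ring
  rw [expand]
  have h2 : 1 / (2 * m) * (2 * m * ∑ i, F i * log (F i) - 2 * T * ∑ i, log (F i)) =
      ∑ i, F i * log (F i) - T * ((∑ i, log (F i)) / m) := by
    field_simp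
  rw [h2]
  have h3 : (∑ i, log (F i)) / m ≤ log (T / m) := by
    rw [div_le_iff₀ hmpos]; linarith
  nlinarith [mul_le_mul_of_nonneg_left h3 hTpos.le]

section Perm

open Equiv

/-- The Dirichlet form of the transposition `(i j)` on the symmetric group. -/
def swapForm {n : ℕ} (f : Perm (Fin n) → ℝ) (i j : Fin n) : ℝ :=
  ∑ σ, logDiff (f σ) (f (σ * swap i j))

theorem swapForm_self {n : ℕ} (f : Perm (Fin n) → ℝ) (i : Fin n) : swapForm f i i = 0 := by
  simp [swapForm, ← Perm.one_def, logDiff_self]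

theorem swapForm_nonneg {n : ℕ} {f : Perm (Fin n) → ℝ} (hf : ∀ σ, 0 < f σ) (i j : Fin n) :
    0 ≤ swapForm f i j :=
  sum_nonneg fun _ _ => logDiff_nonneg (hf _) (hf _)

/-- The entropy functional of `f` under the counting measure on the symmetric group. -/
def permEnt {n : ℕ} (f : Perm (Fin n) → ℝ) : ℝ :=
  ∑ σ, f σ * log (f σ) - (∑ σ, f σ) * log ((∑ σ, f σ) / n.factorial)

theorem sum_perm_eq_sum_decomposeFin {n : ℕ} (h : Perm (Fin (n + 1)) → ℝ) :
    ∑ σ, h σ = ∑ p, ∑ e, h (Perm.decomposeFin.symm (p, e)) := by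
  rw [← Fintype.sum_prod_type', ← Equiv.sum_comp Perm.decomposeFin.symm h]

theorem decomposeFin_symm_mul_swap {n : ℕ} (p : Fin (n + 1)) (e : Perm (Fin n)) (a b : Fin n) :
    Perm.decomposeFin.symm (p, e * swap a b) =
      Perm.decomposeFin.symm (p, e) * swap a.succ b.succ := by
  ext k
  congr 1
  refine Fin.cases ?_ (fun k => ?_) k
  · rw [Perm.mul_apply, swap_apply_of_ne_of_ne (Fin.succ_ne_zero a).symm (Fin.succ_ne_zero b).symm]
    simp
  · rw [Perm.mul_apply, ← Function.Injective.map_swap (Fin.succ_injective n)]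
    simp

theorem permEnt_le_of_fix_zero {n : ℕ} {C : ℝ}
    (ih : ∀ g : Perm (Fin n) → ℝ, (∀ σ, 0 < g σ) → permEnt g ≤ C * ∑ a, ∑ b, swapForm g a b)
    (f : Perm (Fin (n + 1)) → ℝ) (hf : ∀ σ, 0 < f σ) :
    permEnt f ≤ C * ∑ a : Fin n, ∑ b : Fin n, swapForm f a.succ b.succ +
      1 / (2 * (n + 1)) * ∑ j, swapForm f 0 j := by
  set g : Fin (n + 1) → Perm (Fin n) → ℝ := fun p e => f (Perm.decomposeFin.symm (p, e)) with hg
  set F : Fin (n + 1) → ℝ := fun p => ∑ e, g p e with hFdef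
  have hFpos : ∀ p, 0 < F p := fun p => sum_pos (fun _ _ => hf _) univ_nonempty
  have hT : ∑ σ, f σ = ∑ p, F p := sum_perm_eq_sum_decomposeFin f
  have hTpos : 0 < ∑ p, F p := sum_pos (fun p _ => hFpos p) univ_nonempty
  have hfac : (0 : ℝ) < n.factorial := by exact_mod_cast n.factorial_pos
  have fibers : ∑ p, permEnt (g p) ≤ C * ∑ a : Fin n, ∑ b : Fin n, swapForm f a.succ b.succ := by
    calc ∑ p, permEnt (g p) ≤ ∑ p, C * ∑ a, ∑ b, swapForm (g p) a b :=
          sum_le_sum fun p _ => ih (g p) fun _ => hf _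
      _ = C * ∑ a : Fin n, ∑ b : Fin n, ∑ p, swapForm (g p) a b := by
          rw [← mul_sum, sum_comm]
          congr 1
          exact sum_congr rfl fun a _ => sum_comm
      _ = _ := by
          congr 1
          refine sum_congr rfl fun a _ => sum_congr rfl fun b _ => ?_
          simp only [swapForm, hg, decomposeFin_symm_mul_swap]
          rw [sum_perm_eq_sum_decomposeFin]
  have base := sum_mul_log_le_complete F hFpos
  have hF_filter : ∀ p, F p = ∑ σ with σ 0 = p, f σ := by
    intro p
    rw [sum_filter, sum_perm_eq_sum_decomposeFin]
    simp [hFdef, hg]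
  have hF_filter' : ∀ p q, F q = ∑ σ with σ 0 = p, f (swap p q * σ) := by
    intro p q
    rw [hF_filter]
    refine sum_bij' (fun σ _ => swap p q * σ) (fun σ _ => swap p q * σ) ?_ ?_ ?_ ?_ ?_ <;>
      simp +contextual [swap_mul_self_mul]
  have pair : ∑ p, ∑ q, logDiff (F p) (F q) ≤ ∑ j, swapForm f 0 j := by
    calc ∑ p, ∑ q, logDiff (F p) (F q)
        ≤ ∑ p, ∑ q, ∑ σ with σ 0 = p, logDiff (f σ) (f (swap p q * σ)) := by
          refine sum_le_sum fun p _ => sum_le_sum fun q _ => ?_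
          rw [hF_filter p, hF_filter' p q]
          exact logDiff_sum_le _ _ _ (fun _ _ => hf _) fun _ _ => hf _
      _ = ∑ σ, ∑ q, logDiff (f σ) (f (swap (σ 0) q * σ)) := by
          rw [← sum_fiberwise (s := univ) (g := fun σ : Perm (Fin (n + 1)) => σ 0)]
          refine sum_congr rfl fun p _ => ?_
          rw [sum_comm]
          refine sum_congr rfl fun σ hσ => ?_
          rw [(mem_filter.1 hσ).2]
      _ = ∑ σ, ∑ j, logDiff (f σ) (f (σ * swap 0 j)) := by
          refine sum_congr rfl fun σ _ => ?_
          rw [← Equiv.sum_comp σ⁻¹ fun j => logDiff (f σ) (f (σ * swap 0 j))]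
          simp [Equiv.swap_mul_eq_mul_swap]
      _ = ∑ j, swapForm f 0 j := sum_comm
  have chain : permEnt f = ∑ p, permEnt (g p) + (∑ p, F p * log (F p) -
      (∑ p, F p) * log ((∑ p, F p) / Fintype.card (Fin (n + 1)))) := by
    have h1 : ∀ p, permEnt (g p) = ∑ e, g p e * log (g p e) -
        (F p * log (F p) - F p * log n.factorial) := by
      intro p
      rw [permEnt, ← mul_sub, ← log_div (hFpos p).ne' hfac.ne']
    simp only [h1, sum_sub_distrib, ← sum_mul]
    rw [permEnt, hT, sum_perm_eq_sum_decomposeFin, Fintype.card_fin, Nat.factorial_succ,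
      Nat.cast_mul, log_div hTpos.ne' (by positivity), log_div hTpos.ne' (by positivity),
      log_mul (by positivity) hfac.ne']
    ring
  rw [chain]
  refine add_le_add fibers (base.trans ?_)
  rw [Fintype.card_fin, Nat.cast_succ]
  exact mul_le_mul_of_nonneg_left pair (by positivity)

/-- The modified log-Sobolev inequality for random transpositions. -/
theorem permEnt_le {n : ℕ} (f : Perm (Fin n) → ℝ) (hf : ∀ σ, 0 < f σ) :
    permEnt f ≤ 1 / (2 * n) * ∑ i, ∑ j, swapForm f i j := by
  induction n with
  | zero => simp [permEnt]
  | succ n ih =>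
    have translate : ∀ i, permEnt f ≤ 1 / (2 * n) *
        ∑ a, ∑ b, (if i ≠ a ∧ i ≠ b then swapForm f a b else 0) +
        1 / (2 * (n + 1)) * ∑ j, swapForm f i j := by
      intro i
      set ρ : Perm (Fin (n + 1)) := swap 0 i with hρ
      have hsum : ∀ h : Perm (Fin (n + 1)) → ℝ, ∑ σ, h (σ * ρ) = ∑ σ, h σ := fun h =>
        Equiv.sum_comp (Equiv.mulRight ρ) h
      have hform : ∀ a b, swapForm (fun σ => f (σ * ρ)) a b = swapForm f (ρ a) (ρ b) := by
        intro a b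
        have : ∀ σ, σ * swap a b * ρ = σ * ρ * swap (ρ a) (ρ b) := by
          intro σ
          rw [mul_assoc, mul_assoc, Equiv.swap_mul_eq_mul_swap]
          simp [hρ]
        simp only [swapForm, this]
        exact hsum fun σ => logDiff (f σ) (f (σ * swap (ρ a) (ρ b)))
      have hent : permEnt (fun σ => f (σ * ρ)) = permEnt f := by
        simp only [permEnt, hsum f, hsum fun σ => f σ * log (f σ)]
      have h := permEnt_le_of_fix_zero ih (fun σ => f (σ * ρ)) fun _ => hf _
      rw [hent] at h
      simp only [hform] at h
      have h0 : ρ 0 = i := by simp [hρ]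
      rw [h0, Equiv.sum_comp ρ fun j => swapForm f i j] at h
      refine h.trans_eq ?_
      congr 2
      rw [← Equiv.sum_comp ρ]
      simp only [← Equiv.sum_comp ρ (fun b => if i ≠ _ ∧ i ≠ b then _ else _)]
      rw [Fin.sum_univ_succ]
      simp only [Fin.sum_univ_succ, h0]
      simp [← h0, (Fin.succ_ne_zero _).symm]
    have total := sum_le_sum fun i (_ : i ∈ (univ : Finset (Fin (n + 1)))) => translate i
    rw [sum_const, card_univ, Fintype.card_fin, nsmul_eq_mul, sum_add_distrib, ← mul_sum,
      ← mul_sum] at total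
    have count : ∑ i, ∑ a, ∑ b, (if i ≠ a ∧ i ≠ b then swapForm f a b else 0) =
        ((n : ℝ) - 1) * ∑ a, ∑ b, swapForm f a b := by
      rw [sum_comm, mul_sum]
      refine sum_congr rfl fun a _ => ?_
      rw [sum_comm, mul_sum]
      refine sum_congr rfl fun b _ => ?_
      rcases eq_or_ne a b with rfl | hab
      · simp [swapForm_self]
      rw [← sum_filter, sum_const, nsmul_eq_mul]
      congr 1
      have : (univ.filter fun i => i ≠ a ∧ i ≠ b) = ({a, b} : Finset (Fin (n + 1)))ᶜ := by
        ext i; simp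
      rw [this, card_compl, card_pair hab, Fintype.card_fin]
      have : 2 ≤ n + 1 := by
        have := card_le_univ ({a, b} : Finset (Fin (n + 1)))
        rwa [card_pair hab, Fintype.card_fin] at this
      rw [Nat.cast_sub this]
      push_cast
      ring
    rw [count] at total
    set S := ∑ a, ∑ b, swapForm f a b with hS
    have hS0 : 0 ≤ S := sum_nonneg fun a _ => sum_nonneg fun b _ => swapForm_nonneg hf a b
    push_cast at total ⊢
    have hcoef : 1 / (2 * (n : ℝ)) * (n - 1) + 1 / (2 * (n + 1)) ≤ 1 / 2 := by
      rcases Nat.eq_zero_or_pos n with rfl | hn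
      · norm_num
      have : (0 : ℝ) < n := by exact_mod_cast hn
      rw [div_mul_eq_mul_div, div_add_div _ _ (by positivity) (by positivity),
        div_le_div_iff₀ (by positivity) (by positivity)]
      nlinarith
    have hn1 : (0 : ℝ) < n + 1 := by positivity
    rw [one_div_mul_eq_div, le_div_iff₀ (by positivity)]
    nlinarith [mul_le_mul_of_nonneg_right hcoef hS0]

end Perm

/-- A differential form of Herbst's argument: `ψ(λ) (1 - Bλ) / λ` is nonincreasing through `0`. -/
theorem herbst_add_nonpos {ψ ψ' : ℝ → ℝ} {B a b : ℝ} (ha : 0 < a) (hb : 0 < b)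
    (hψ : ∀ t, HasDerivAt ψ (ψ' t) t) (h0 : ψ 0 = 0) (hm : 0 ≤ ψ' 0)
    (hent : ∀ t ∈ Set.Icc (-a) b, t * ψ' t - ψ t ≤ B * t ^ 2 * ψ' t)
    (hB : 0 < 1 / b - B) (hab : 1 / a + B ≤ 1 / b - B) (hBa : 0 < 1 / a + B) :
    ψ (-a) + ψ b ≤ 0 := by
  set ρ : ℝ → ℝ := fun t => dslope ψ 0 t - B * ψ t with hρ
  have hcont : Continuous ρ := by
    have hψc : Continuous ψ := continuous_iff_continuousAt.2 fun t => (hψ t).continuousAt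
    refine Continuous.sub (continuous_iff_continuousAt.2 fun t => ?_) (hψc.const_mul B)
    rcases eq_or_ne t 0 with rfl | ht
    · exact continuousAt_dslope_same.2 (hψ 0).differentiableAt
    · exact (continuousAt_dslope_of_ne ht).2 (hψ t).continuousAt
  have hderiv : ∀ t ≠ 0, HasDerivAt ρ ((ψ' t * t - ψ t * 1) / t ^ 2 - B * ψ' t) t := by
    intro t ht
    have h := ((hψ t).div (hasDerivAt_id t) ht).sub ((hψ t).const_mul B)
    refine h.congr_of_eventuallyEq ?_
    filter_upwards [isOpen_ne.mem_nhds ht] with u hu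
    rw [hρ]
    simp [dslope_of_ne _ hu, slope_def_field, h0]
  have hneg : ∀ t ∈ Set.Icc (-a) b, t ≠ 0 → deriv ρ t ≤ 0 := by
    intro t ht h
    have ht2 : 0 < t ^ 2 := by positivity
    rw [(hderiv t h).deriv, sub_nonpos, div_le_iff₀ ht2]
    linarith [hent t ht]
  have hρ0 : ρ 0 = ψ' 0 := by simp [hρ, h0, dslope_same, (hψ 0).deriv]
  have hval : ∀ t ≠ 0, ρ t = ψ t * (1 / t - B) := by
    intro t ht
    simp only [hρ, dslope_of_ne _ ht, slope_def_field, h0]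
    ring
  have hright : ρ b ≤ ρ 0 := by
    refine antitoneOn_of_deriv_nonpos (convex_Icc 0 b) hcont.continuousOn ?_ ?_
      (Set.left_mem_Icc.2 hb.le) (Set.right_mem_Icc.2 hb.le) hb.le <;>
      rw [interior_Icc]
    · exact fun t ht => (hderiv t ht.1.ne').differentiableAt.differentiableWithinAt
    · exact fun t ht => hneg t ⟨by linarith [ht.1], ht.2.le⟩ ht.1.ne'
  have hleft : ρ 0 ≤ ρ (-a) := by
    have ha' : -a ≤ 0 := by linarith
    refine antitoneOn_of_deriv_nonpos (convex_Icc (-a) 0) hcont.continuousOn ?_ ?_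
      (Set.left_mem_Icc.2 ha') (Set.right_mem_Icc.2 ha') ha' <;>
      rw [interior_Icc]
    · exact fun t ht => (hderiv t ht.2.ne).differentiableAt.differentiableWithinAt
    · exact fun t ht => hneg t ⟨ht.1.le, by linarith [ht.2]⟩ ht.2.ne
  rw [hρ0, hval b hb.ne', ← le_div_iff₀ hB] at hright
  rw [hρ0, hval (-a) (neg_ne_zero.2 ha.ne')] at hleft
  have hleft' : ψ' 0 / (1 / a + B) ≤ -ψ (-a) := by
    rw [div_le_iff₀ hBa]
    rw [one_div_neg_eq_neg_one_div] at hleft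
    linarith
  have := div_le_div_of_nonneg_left hm hBa hab
  linarith

section Perm

open Equiv

theorem logDiff_exp_le {u v t : ℝ} (ht : -(1 / 64) ≤ t) (huv : u ≤ v + 4) (hvu : v ≤ u) :
    logDiff (exp (t * u)) (exp (t * v)) ≤ 2 * t ^ 2 * ((u - v) ^ 2 * exp (t * u)) := by
  rw [logDiff, log_exp, log_exp]
  have hd : 0 ≤ u - v := sub_nonneg.2 hvu
  have hE := exp_pos (t * u)
  have hprod : exp (t * v) = exp (t * u) * exp (-(t * (u - v))) := by
    rw [← exp_add]; congr 1; ring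
  set y := t * (u - v) with hy
  have hy' : t * u - t * v = y := by rw [hy]; ring
  have hbound : (1 - exp (-y)) * y ≤ 2 * y ^ 2 := by
    have h1 := add_one_le_exp (-y)
    rcases le_total 0 y with h | h
    · nlinarith
    · have hy16 : -y ≤ 1 / 16 := by rw [hy]; nlinarith
      have habs := abs_exp_sub_one_le (x := -y) (by rw [abs_of_nonneg] <;> linarith)
      rw [abs_of_nonneg (neg_nonneg.2 h)] at habs
      have := (abs_le.1 habs).2
      nlinarith
  rw [hy', hprod]
  have : 2 * t ^ 2 * ((u - v) ^ 2 * exp (t * u)) = exp (t * u) * (2 * y ^ 2) := by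
    rw [hy]; ring
  rw [this]
  have := mul_le_mul_of_nonneg_left hbound hE.le
  linarith

theorem swapForm_exp_le {n : ℕ} {G : Perm (Fin n) → ℝ} {t : ℝ} (ht : -(1 / 64) ≤ t) (i j : Fin n)
    (hG : ∀ σ, G σ ≤ G (σ * swap i j) + 4) :
    swapForm (fun σ => exp (t * G σ)) i j ≤
      4 * t ^ 2 * ∑ σ, max (G σ - G (σ * swap i j)) 0 ^ 2 * exp (t * G σ) := by
  set W : Perm (Fin n) → ℝ := fun σ =>
    max (G σ - G (σ * swap i j)) 0 ^ 2 * exp (t * G σ) with hW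
  have hinv : ∀ σ, σ * swap i j * swap i j = σ := fun σ => by simp [mul_assoc]
  have hreindex : ∑ σ, W (σ * swap i j) = ∑ σ, W σ := Equiv.sum_comp (Equiv.mulRight (swap i j)) W
  have hWnonneg : ∀ σ, 0 ≤ W σ := fun σ => by positivity
  have hpoint : ∀ σ, logDiff (exp (t * G σ)) (exp (t * G (σ * swap i j))) ≤
      2 * t ^ 2 * (W σ + W (σ * swap i j)) := by
    intro σ
    have h1 := hWnonneg σ
    have h2 := hWnonneg (σ * swap i j)
    rcases le_total (G (σ * swap i j)) (G σ) with h | h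
    · have hlog := logDiff_exp_le ht (hG σ) h
      have : W σ = (G σ - G (σ * swap i j)) ^ 2 * exp (t * G σ) := by
        simp only [hW]; rw [max_eq_left (sub_nonneg.2 h)]
      rw [← this] at hlog
      nlinarith [mul_nonneg (sq_nonneg t) h2]
    · have hlog := logDiff_exp_le ht (by simpa [hinv] using hG (σ * swap i j)) h
      have : W (σ * swap i j) =
          (G (σ * swap i j) - G σ) ^ 2 * exp (t * G (σ * swap i j)) := by
        simp only [hW]; rw [hinv, max_eq_left (sub_nonneg.2 h)]
      rw [← this] at hlog
      rw [logDiff_comm]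
      nlinarith [mul_nonneg (sq_nonneg t) h1]
  calc swapForm (fun σ => exp (t * G σ)) i j
      ≤ ∑ σ, 2 * t ^ 2 * (W σ + W (σ * swap i j)) := sum_le_sum fun σ _ => hpoint σ
    _ = 4 * t ^ 2 * ∑ σ, W σ := by
      rw [← mul_sum, sum_add_distrib, hreindex]; ring

/-- A nonnegative functional with self-bounded discrete gradient satisfies a two-sided exponential
concentration bound on the symmetric group. -/
theorem avg_exp_mul_avg_exp_le_one {n : ℕ} {G : Perm (Fin n) → ℝ} (hnonneg : ∀ σ, 0 ≤ G σ)
    (hG : ∀ σ i j, G σ ≤ G (σ * swap i j) + 4)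
    (hgrad : ∀ σ, ∑ i, ∑ j, max (G σ - G (σ * swap i j)) 0 ^ 2 ≤ 16 * n * G σ) :
    (∑ σ, exp (-(1 / 64) * G σ)) / n.factorial * ((∑ σ, exp (1 / 144 * G σ)) / n.factorial) ≤ 1 := by
  have hfac : (0 : ℝ) < n.factorial := by exact_mod_cast n.factorial_pos
  set Z : ℝ → ℝ := fun t => ∑ σ, exp (t * G σ) with hZ
  set Z' : ℝ → ℝ := fun t => ∑ σ, G σ * exp (t * G σ) with hZ'
  have hZpos : ∀ t, 0 < Z t := fun t => sum_pos (fun _ _ => exp_pos _) univ_nonempty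
  have hZ'nonneg : ∀ t, 0 ≤ Z' t := fun t =>
    sum_nonneg fun σ _ => mul_nonneg (hnonneg σ) (exp_pos _).le
  have hZderiv : ∀ t, HasDerivAt Z (Z' t) t := by
    intro t
    refine HasDerivAt.fun_sum fun σ _ => ?_
    have := ((hasDerivAt_id t).mul_const (G σ)).exp
    simpa [mul_comm] using this
  have hψ : ∀ t, HasDerivAt (fun t => log (Z t / n.factorial)) (Z' t / Z t) t := by
    intro t
    have := ((hZderiv t).div_const (n.factorial : ℝ)).log (div_pos (hZpos t) hfac).ne'
    convert this using 1
    field_simp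
  have hent : ∀ t ∈ Set.Icc (-(1 / 64) : ℝ) (1 / 144),
      t * (Z' t / Z t) - log (Z t / n.factorial) ≤ 32 * t ^ 2 * (Z' t / Z t) := by
    intro t ht
    have hls := permEnt_le (fun σ => exp (t * G σ)) fun _ => exp_pos _
    have hforms : 1 / (2 * (n : ℝ)) * ∑ i, ∑ j, swapForm (fun σ => exp (t * G σ)) i j ≤
        32 * t ^ 2 * Z' t := by
      have h1 : ∑ i, ∑ j, swapForm (fun σ => exp (t * G σ)) i j ≤
          4 * t ^ 2 * (16 * n * Z' t) := by
        calc ∑ i, ∑ j, swapForm (fun σ => exp (t * G σ)) i j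
            ≤ ∑ i, ∑ j, 4 * t ^ 2 *
              ∑ σ, max (G σ - G (σ * swap i j)) 0 ^ 2 * exp (t * G σ) :=
              sum_le_sum fun i _ => sum_le_sum fun j _ =>
                swapForm_exp_le ht.1 i j fun σ => hG σ i j
          _ = 4 * t ^ 2 * ∑ σ, (∑ i, ∑ j, max (G σ - G (σ * swap i j)) 0 ^ 2) *
              exp (t * G σ) := by
              simp only [← mul_sum, sum_mul]
              congr 1
              rw [sum_comm]
              conv_rhs => rw [sum_comm]; enter [2, i]; rw [sum_comm]
              rw [sum_comm]
          _ ≤ 4 * t ^ 2 * ∑ σ, (16 * n * G σ) * exp (t * G σ) := by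
              refine mul_le_mul_of_nonneg_left (sum_le_sum fun σ _ => ?_) (by positivity)
              exact mul_le_mul_of_nonneg_right (hgrad σ) (exp_pos _).le
          _ = _ := by simp only [hZ', mul_sum, mul_assoc]
      rcases Nat.eq_zero_or_pos n with rfl | hn
      · simpa using mul_nonneg (by positivity : (0:ℝ) ≤ 32 * t ^ 2) (hZ'nonneg t)
      have hn' : (0 : ℝ) < n := by exact_mod_cast hn
      rw [one_div_mul_eq_div, div_le_iff₀ (by positivity)]
      linarith
    have hleft : permEnt (fun σ => exp (t * G σ)) = t * Z' t - Z t * log (Z t / n.factorial) := by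
      simp only [permEnt, log_exp, hZ, hZ', mul_sum]
      congr 1
      exact sum_congr rfl fun σ _ => by ring
    rw [hleft] at hls
    have := div_le_div_of_nonneg_right (hls.trans hforms) (hZpos t).le
    rw [sub_div, mul_div_cancel_left₀ _ (hZpos t).ne', mul_div_assoc, mul_div_assoc] at this
    exact this
  have hZ0 : Z 0 = n.factorial := by simp [hZ, Fintype.card_perm]
  have hsum := herbst_add_nonpos (B := 32) (a := 1 / 64) (b := 1 / 144) (by norm_num)
    (by norm_num) hψ (by simp [hZ0, hfac.ne']) (div_nonneg (hZ'nonneg 0) (hZpos 0).le)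
    hent (by norm_num) (by norm_num) (by norm_num)
  rw [← log_mul (div_pos (hZpos _) hfac).ne' (div_pos (hZpos _) hfac).ne'] at hsum
  exact (log_nonpos_iff (mul_pos (div_pos (hZpos _) hfac) (div_pos (hZpos _) hfac)).le).1 hsum

end Perm

/-- The `0`-`1` vector recording the coordinates in which two words differ. -/
def mismatch {N : ℕ} (ω a : Fin N → ℝ) : EuclideanSpace ℝ (Fin N) :=
  WithLp.toLp 2 fun k => if ω k = a k then 0 else 1

theorem mem_Icc_of_mem_convexHull_mismatch {N : ℕ} {ω : Fin N → ℝ} {A : Set (Fin N → ℝ)}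
    {w : EuclideanSpace ℝ (Fin N)} (hw : w ∈ convexHull ℝ (mismatch ω '' A)) (k : Fin N) :
    w k ∈ Set.Icc (0 : ℝ) 1 := by
  have hconv : Convex ℝ {w : EuclideanSpace ℝ (Fin N) | w k ∈ Set.Icc (0 : ℝ) 1} :=
    (convex_Icc (0 : ℝ) 1).linear_preimage (EuclideanSpace.proj (𝕜 := ℝ) k).toLinearMap
  refine convexHull_min ?_ hconv hw
  rintro _ ⟨a, -, rfl⟩
  simp only [mismatch, Set.mem_ofPred_eq]
  split_ifs <;> simp

theorem le_inner_of_mem_convexHull {E : Type*} [NormedAddCommGroup E] [InnerProductSpace ℝ E]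
    {S : Set E} {v w : E} {c : ℝ} (h : ∀ u ∈ S, c ≤ inner ℝ v u) (hw : w ∈ convexHull ℝ S) :
    c ≤ inner ℝ v w :=
  convexHull_min h (convex_halfSpace_ge (innerₗ E v).isLinear c) hw

theorem exists_min_norm_mem_convexHull {E : Type*} [NormedAddCommGroup E]
    [InnerProductSpace ℝ E] [FiniteDimensional ℝ E] {S : Set E} (hS : S.Finite)
    (hne : S.Nonempty) :
    ∃ s ∈ convexHull ℝ S, ∀ w ∈ convexHull ℝ S, ‖s‖ ^ 2 ≤ inner ℝ s w := by
  have hconv := convex_convexHull ℝ S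
  obtain ⟨s, hs, hmin⟩ := exists_norm_eq_iInf_of_complete_convex hne.convexHull
    (hS.isCompact_convexHull ℝ).isComplete hconv (0 : E)
  refine ⟨s, hs, fun w hw => ?_⟩
  have := (norm_eq_iInf_iff_real_inner_le_zero hconv hs).1 hmin w hw
  rw [zero_sub, inner_neg_left, inner_sub_right, real_inner_self_eq_norm_sq] at this
  linarith

theorem convexDist_nonneg {N : ℕ} (ω : Fin N → ℝ) (A : Set (Fin N → ℝ)) :
    0 ≤ convexDist ω A := by
  refine Real.sSup_nonneg ?_
  rintro _ ⟨α, -, rfl⟩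
  refine Real.sInf_nonneg ?_
  rintro _ ⟨a, -, rfl⟩
  exact sum_nonneg fun k _ => mul_nonneg (abs_nonneg _) (by split_ifs <;> simp)

theorem convexDist_le_norm {N : ℕ} {ω : Fin N → ℝ} {A : Set (Fin N → ℝ)}
    {w : EuclideanSpace ℝ (Fin N)} (hw : w ∈ convexHull ℝ (mismatch ω '' A)) :
    convexDist ω A ≤ ‖w‖ := by
  refine Real.sSup_le ?_ (norm_nonneg w)
  rintro _ ⟨α, hα, rfl⟩
  set v : EuclideanSpace ℝ (Fin N) := WithLp.toLp 2 fun k => |α k| with hv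
  have hnorm : ‖v‖ = 1 := by
    rw [EuclideanSpace.norm_eq]
    simp [hv, hα]
  have hle : ∀ u ∈ mismatch ω '' A, sInf { s : ℝ | ∃ ω' ∈ A,
      s = ∑ i, |α i| * (if ω i = ω' i then (0 : ℝ) else 1) } ≤ inner ℝ v u := by
    rintro _ ⟨a, ha, rfl⟩
    refine csInf_le ⟨0, ?_⟩ ⟨a, ha, ?_⟩
    · rintro _ ⟨a, -, rfl⟩
      exact sum_nonneg fun k _ => mul_nonneg (abs_nonneg _) (by split_ifs <;> simp)
    · simp [PiLp.inner_apply, hv, mismatch]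
  calc _ ≤ inner ℝ v w := le_inner_of_mem_convexHull hle hw
    _ ≤ ‖v‖ * ‖w‖ := real_inner_le_norm v w
    _ = ‖w‖ := by rw [hnorm, one_mul]

/-- Altering a word in two coordinates lowers the squared distance to the hull only by the
weight of these coordinates in the minimizer. -/
theorem norm_sq_le_add_of_eq_off_pair {N : ℕ} {ω ω' : Fin N → ℝ} {A : Set (Fin N → ℝ)}
    {s s' : EuclideanSpace ℝ (Fin N)} {i j : Fin N}
    (hs : s ∈ convexHull ℝ (mismatch ω '' A))
    (hmin : ∀ w ∈ convexHull ℝ (mismatch ω '' A), ‖s‖ ^ 2 ≤ inner ℝ s w)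
    (hs' : s' ∈ convexHull ℝ (mismatch ω' '' A))
    (hω : ∀ k, k ≠ i → k ≠ j → ω' k = ω k) :
    ‖s‖ ^ 2 ≤ ‖s'‖ ^ 2 + 2 * (s i + s j) := by
  have hcoord := mem_Icc_of_mem_convexHull_mismatch hs
  have hle : ∀ u ∈ mismatch ω' '' A, ‖s‖ ^ 2 - (s i + s j) ≤ inner ℝ s u := by
    rintro _ ⟨a, ha, rfl⟩
    have h1 := hmin _ (subset_convexHull ℝ _ ⟨a, ha, rfl⟩)
    have h2 : inner ℝ s (mismatch ω a) - (s i + s j) ≤ inner ℝ s (mismatch ω' a) := by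
      have hsum : s i + s j = ∑ k, s k * ((if k = i then 1 else 0) + (if k = j then 1 else 0)) := by
        simp [mul_add, sum_add_distrib]
      rw [hsum, PiLp.inner_apply, PiLp.inner_apply, ← sum_sub_distrib]
      refine sum_le_sum fun k _ => ?_
      have hk := (hcoord k).1
      simp only [mismatch, RCLike.inner_apply, conj_trivial]
      by_cases hki : k = i
      · simp only [hki, if_true]; rw [hki] at hk; split_ifs <;> nlinarith
      by_cases hkj : k = j
      · simp only [hkj, if_true]; rw [hkj] at hk; split_ifs <;> nlinarith
      simp [hki, hkj, hω k hki hkj]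
    linarith
  have h := le_inner_of_mem_convexHull hle hs'
  have hsq := sq_nonneg ‖s - s'‖
  rw [norm_sub_sq_real] at hsq
  linarith

open Equiv in
theorem exists_perm_comp_eq {L N : ℕ} {κ : Fin L → ℕ} {x : Fin L → ℝ} {ω ω' : Fin N → ℝ}
    (hω : ω ∈ multislice L N κ x) (hω' : ω' ∈ multislice L N κ x) :
    ∃ τ : Perm (Fin N), ω ∘ τ = ω' := by
  simp only [multislice, mem_filter, Fintype.mem_piFinset, mem_image, mem_univ, true_and]
    at hω hω'
  have hcard : ∀ y, Nonempty ({i // ω' i = y} ≃ {i // ω i = y}) := by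
    intro y
    refine Fintype.card_eq.1 ?_
    rw [Fintype.card_subtype, Fintype.card_subtype]
    by_cases hy : ∃ ℓ, x ℓ = y
    · obtain ⟨ℓ, rfl⟩ := hy
      rw [hω.2 ℓ, hω'.2 ℓ]
    · have h0 : ∀ η : Fin N → ℝ, (∀ i, ∃ ℓ, x ℓ = η i) → (univ.filter fun i => η i = y) = ∅ := by
        intro η hη
        refine filter_eq_empty_iff.2 fun i _ hi => hy ?_
        rw [← hi]; exact hη i
      rw [h0 ω hω.1, h0 ω' hω'.1]
  let e := fun y => (hcard y).some
  refine ⟨(sigmaFiberEquiv ω').symm.trans ((sigmaCongrRight e).trans (sigmaFiberEquiv ω)), ?_⟩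
  funext i
  exact (e (ω' i) ⟨i, rfl⟩).2

theorem comp_perm_mem_multislice {L N : ℕ} {κ : Fin L → ℕ} {x : Fin L → ℝ} {ω : Fin N → ℝ}
    (hω : ω ∈ multislice L N κ x) (σ : Equiv.Perm (Fin N)) : ω ∘ σ ∈ multislice L N κ x := by
  simp only [multislice, mem_filter, Fintype.mem_piFinset] at hω ⊢
  refine ⟨fun i => hω.1 (σ i), fun ℓ => ?_⟩
  rw [← hω.2 ℓ]
  exact card_bij (fun i _ => σ i) (by simp) (by simp) fun i hi => ⟨σ.symm i, by simpa using hi⟩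

/-- The orbit map of a point pushes the uniform measure on permutations to the uniform measure on
the multislice. -/
theorem uexpect_multislice_eq {L N : ℕ} {κ : Fin L → ℕ} {x : Fin L → ℝ} {ω₀ : Fin N → ℝ}
    (hω₀ : ω₀ ∈ multislice L N κ x) (F : (Fin N → ℝ) → ℝ) :
    uexpect (multislice L N κ x) F =
      (∑ σ : Equiv.Perm (Fin N), F (ω₀ ∘ σ)) / N.factorial := by
  set Ω := multislice L N κ x with hΩ
  have hcard : (0 : ℝ) < Ω.card := by exact_mod_cast card_pos.2 ⟨ω₀, hω₀⟩
  have hfac : (0 : ℝ) < N.factorial := by exact_mod_cast N.factorial_pos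
  have orbit : ∀ ω ∈ Ω, ∑ σ : Equiv.Perm (Fin N), F (ω ∘ σ) =
      ∑ σ : Equiv.Perm (Fin N), F (ω₀ ∘ σ) := by
    intro ω hω
    obtain ⟨τ, rfl⟩ := exists_perm_comp_eq hω₀ hω
    exact Equiv.sum_comp (Equiv.mulLeft τ) fun σ : Equiv.Perm (Fin N) => F (ω₀ ∘ σ)
  have invariant : ∀ σ : Equiv.Perm (Fin N), ∑ ω ∈ Ω, F (ω ∘ σ) = ∑ ω ∈ Ω, F ω := by
    intro σ
    refine sum_bij' (fun ω _ => ω ∘ σ) (fun ω _ => ω ∘ σ.symm)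
      (fun ω hω => comp_perm_mem_multislice hω σ)
      (fun ω hω => comp_perm_mem_multislice hω σ.symm) ?_ ?_ ?_ <;>
      simp [Function.comp_assoc]
  have double := sum_congr rfl orbit
  rw [sum_comm, sum_congr rfl fun σ _ => invariant σ] at double
  simp only [sum_const, card_univ, Fintype.card_perm, Fintype.card_fin, nsmul_eq_mul] at double
  rw [uexpect, div_eq_div_iff hcard.ne' hfac.ne']
  linarith

theorem uprob_eq_uexpect {α : Type*} (Ω : Finset α) (p : α → Prop) :
    uprob Ω p = uexpect Ω fun ω => if p ω then 1 else 0 := by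
  simp [uprob, uexpect]

theorem uexpect_mono {α : Type*} {Ω : Finset α} {f g : α → ℝ} (h : ∀ ω ∈ Ω, f ω ≤ g ω) :
    uexpect Ω f ≤ uexpect Ω g :=
  div_le_div_of_nonneg_right (sum_le_sum h) (Nat.cast_nonneg _)

theorem uexpect_nonneg {α : Type*} {Ω : Finset α} {f : α → ℝ} (h : ∀ ω ∈ Ω, 0 ≤ f ω) :
    0 ≤ uexpect Ω f :=
  div_nonneg (sum_nonneg h) (Nat.cast_nonneg _)

/-- Talagrand's convex distance inequality for the multislice. -/
theorem stmt8 (L N : ℕ) (hL : 2 ≤ L) (κ : Fin L → ℕ) (hκ : ∀ ℓ, 1 ≤ κ ℓ)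
    (hN : N = ∑ ℓ, κ ℓ) (x : Fin L → ℝ) (hx : StrictMono x)
    (A : Set (Fin N → ℝ)) (hA : A ⊆ ↑(multislice L N κ x)) :
    uprob (multislice L N κ x) (fun ω => ω ∈ A) *
      uexpect (multislice L N κ x) (fun ω => Real.exp (convexDist ω A ^ 2 / 144)) ≤ 1 := by
  rcases A.eq_empty_or_nonempty with rfl | ⟨ω₀, hω₀⟩
  · simp [uprob]
  have hfin : A.Finite := (finite_toSet _).subset hA
  choose s hs hmin using fun ω => exists_min_norm_mem_convexHull (hfin.image (mismatch ω))
    (Set.Nonempty.image (mismatch ω) ⟨ω₀, hω₀⟩)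
  have hbox := fun ω => mem_Icc_of_mem_convexHull_mismatch (hs ω)
  have hzero : ∀ ω ∈ A, ‖s ω‖ ^ 2 ≤ 0 := by
    intro ω hω
    have h0 : mismatch ω ω = 0 := by ext k; simp [mismatch]
    have := hmin ω (mismatch ω ω) (subset_convexHull ℝ _ ⟨ω, hω, rfl⟩)
    rwa [h0, inner_zero_right] at this
  have hprob : uprob (multislice L N κ x) (fun ω => ω ∈ A) ≤
      uexpect (multislice L N κ x) fun ω => exp (-(1 / 64) * ‖s ω‖ ^ 2) := by
    rw [uprob_eq_uexpect]
    refine uexpect_mono fun ω _ => ?_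
    split_ifs with h
    · exact one_le_exp (by linarith [hzero ω h])
    · exact (exp_pos _).le
  have hexp : uexpect (multislice L N κ x) (fun ω => exp (convexDist ω A ^ 2 / 144)) ≤
      uexpect (multislice L N κ x) fun ω => exp (1 / 144 * ‖s ω‖ ^ 2) := by
    refine uexpect_mono fun ω _ => exp_le_exp.2 ?_
    have := pow_le_pow_left₀ (convexDist_nonneg ω A) (convexDist_le_norm (hs ω)) 2
    linarith
  refine (mul_le_mul hprob hexp (uexpect_nonneg fun _ _ => (exp_pos _).le)
    (uexpect_nonneg fun _ _ => (exp_pos _).le)).trans ?_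
  rw [uexpect_multislice_eq (hA hω₀), uexpect_multislice_eq (hA hω₀)]
  have hdiff : ∀ (σ : Equiv.Perm (Fin N)) (i j : Fin N),
      ‖s (ω₀ ∘ σ)‖ ^ 2 ≤ ‖s (ω₀ ∘ ⇑(σ * Equiv.swap i j))‖ ^ 2 +
        2 * (s (ω₀ ∘ σ) i + s (ω₀ ∘ σ) j) := by
    intro σ i j
    refine norm_sq_le_add_of_eq_off_pair (hs _) (hmin _) (hs _) fun k hki hkj => ?_
    simp [Equiv.swap_apply_of_ne_of_ne hki hkj]
  refine avg_exp_mul_avg_exp_le_one (G := fun σ => ‖s (ω₀ ∘ σ)‖ ^ 2) (fun σ => by positivity)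
    (fun σ i j => ?_) fun σ => ?_
  · have h1 := (hbox (ω₀ ∘ σ) i).2
    have h2 := (hbox (ω₀ ∘ σ) j).2
    linarith [hdiff σ i j]
  · set v := s (ω₀ ∘ σ) with hv
    have hterm : ∀ i j : Fin N,
        max (‖v‖ ^ 2 - ‖s (ω₀ ∘ ⇑(σ * Equiv.swap i j))‖ ^ 2) 0 ^ 2 ≤ 8 * (v i ^ 2 + v j ^ 2) := by
      intro i j
      have h1 : 0 ≤ v i := (hbox (ω₀ ∘ σ) i).1
      have h2 : 0 ≤ v j := (hbox (ω₀ ∘ σ) j).1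
      have hle : max (‖v‖ ^ 2 - ‖s (ω₀ ∘ ⇑(σ * Equiv.swap i j))‖ ^ 2) 0 ≤ 2 * (v i + v j) :=
        max_le (by linarith [hdiff σ i j]) (by positivity)
      have := pow_le_pow_left₀ (le_max_right _ _) hle 2
      nlinarith [sq_nonneg (v i - v j)]
    refine (sum_le_sum fun i _ => sum_le_sum fun j _ => hterm i j).trans_eq ?_
    simp only [← mul_sum, sum_add_distrib, sum_const, card_univ, Fintype.card_fin, nsmul_eq_mul,
      EuclideanSpace.real_norm_sq_eq]
    ring
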